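/- arXiv:1805.01538 — 2 statements merged into one kernel-verified Lean document; each statement's English description precedes it below -/
import Mathlib

section
/- For all integers m, n, r with n ≠ 0 and n+r ≠ 0 (so that F(n) ≠ 0 and F(n+r) ≠ 0) and every nonnegative integer k: ∑_{j=0}^{k} (F(r)/F(n+r))^j · G(m−r+n·j) = (-1)^r · (F(n+r)/F(n)) · G(m) − (-1)^r · (F(r)/F(n)) · (F(r)/F(n+r))^k · G(m+(k+1)·n). -/
/-- A two-sided sequence with the Fibonacci recurrence vanishing at `0` and `1` is zero. -/
theorem eq_zero_of_fib_rec (H : ℤ → ℝ) (h0 : H 0 = 0) (h1 : H 1 = 0)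
    (hH : ∀ m : ℤ, H m = H (m - 1) + H (m - 2)) (m : ℤ) : H m = 0 := by
  have key : H m = 0 ∧ H (m + 1) = 0 := by
    induction m using Int.induction_on with
    | zero => exact ⟨h0, by simpa using h1⟩
    | succ i ih =>
      refine ⟨ih.2, ?_⟩
      have h := hH (i + 1 + 1)
      rw [show (i : ℤ) + 1 + 1 - 1 = i + 1 by ring, show (i : ℤ) + 1 + 1 - 2 = i by ring,
        ih.1, ih.2] at h
      simpa using h
    | pred i ih =>
      have h := hH (-i + 1)
      rw [show -(i : ℤ) + 1 - 1 = -i by ring, show -(i : ℤ) + 1 - 2 = -i - 1 by ring,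
        ih.1, ih.2] at h
      exact ⟨by linarith, by simpa using ih.1⟩
  exact key.1

theorem fib_rec_add (F G : ℤ → ℝ) (hF0 : F 0 = 0) (hF1 : F 1 = 1)
    (hF : ∀ m : ℤ, F m = F (m - 1) + F (m - 2))
    (hG : ∀ m : ℤ, G m = G (m - 1) + G (m - 2)) (a b : ℤ) :
    G (a + b) = F b * G (a + 1) + F (b - 1) * G a := by
  have hFneg : F (-1) = 1 := by
    have h := hF 1
    norm_num [hF0, hF1] at h
    exact h.symm
  have := eq_zero_of_fib_rec (fun b => G (a + b) - F b * G (a + 1) - F (b - 1) * G a)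
    (by simp [hF0, hFneg]) (by simp [hF0, hF1]) (fun b => by
      have h1 := hG (a + b)
      have h2 := hF b
      have h3 := hF (b - 1)
      rw [show b - 1 - 2 = b - 2 - 1 by ring] at h3
      simp only [← add_sub_assoc]
      rw [h1, h2, h3]
      ring) b
  linarith

theorem fib_rec_neg (F : ℤ → ℝ) (hF0 : F 0 = 0) (hF1 : F 1 = 1)
    (hF : ∀ m : ℤ, F m = F (m - 1) + F (m - 2)) (m : ℤ) :
    F (-m) = -((-1 : ℝ) ^ m * F m) := by
  have hFneg : F (-1) = 1 := by
    have h := hF 1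
    norm_num [hF0, hF1] at h
    exact h.symm
  have := eq_zero_of_fib_rec (fun m => (-1 : ℝ) ^ m * F (-m) + F m)
    (by simp [hF0]) (by simp [hFneg, hF1]) (fun m => by
      have h1 := hF (-(m - 2))
      have h2 := hF m
      rw [show -(m - 2) - 1 = -(m - 1) by ring, show -(m - 2) - 2 = -m by ring] at h1
      have e1 : (-1 : ℝ) ^ (m - 1) = -(-1 : ℝ) ^ m := by
        rw [zpow_sub_one₀ (by norm_num)]; norm_num
      have e2 : (-1 : ℝ) ^ (m - 2) = (-1 : ℝ) ^ m := by
        rw [zpow_sub₀ (by norm_num)]; norm_num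
      simp only [e1, e2]
      linear_combination -(-1 : ℝ) ^ m * h1 + h2) m
  have hsq : (-1 : ℝ) ^ m * (-1 : ℝ) ^ m = 1 := by
    rw [← mul_zpow]; norm_num
  linear_combination (-1 : ℝ) ^ m * this - F (-m) * hsq

theorem fib_rec_natCast_pos (F : ℤ → ℝ) (hF0 : F 0 = 0) (hF1 : F 1 = 1)
    (hF : ∀ m : ℤ, F m = F (m - 1) + F (m - 2)) (k : ℕ) :
    0 ≤ F k ∧ 0 < F (k + 1) := by
  induction k with
  | zero => simp [hF0, hF1]
  | succ k ih =>
    have h := hF (k + 1 + 1)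
    rw [show (k : ℤ) + 1 + 1 - 1 = k + 1 by ring, show (k : ℤ) + 1 + 1 - 2 = k by ring] at h
    push_cast
    exact ⟨ih.2.le, by linarith [ih.1, ih.2]⟩

theorem fib_rec_ne_zero (F : ℤ → ℝ) (hF0 : F 0 = 0) (hF1 : F 1 = 1)
    (hF : ∀ m : ℤ, F m = F (m - 1) + F (m - 2)) (n : ℤ) (hn : n ≠ 0) : F n ≠ 0 := by
  have hpos : ∀ i : ℤ, 0 < i → F i ≠ 0 := fun i hi => by
    have h := (fib_rec_natCast_pos F hF0 hF1 hF (i - 1).toNat).2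
    rw [show ((i - 1).toNat : ℤ) + 1 = i by omega] at h
    exact h.ne'
  rcases lt_or_gt_of_ne hn with h | h
  · intro h0
    apply hpos (-n) (by omega)
    rw [fib_rec_neg F hF0 hF1 hF, h0]
    simp
  · exact hpos n h

theorem fib_rec_mul_sub (F G : ℤ → ℝ) (hF0 : F 0 = 0) (hF1 : F 1 = 1)
    (hF : ∀ m : ℤ, F m = F (m - 1) + F (m - 2))
    (hG : ∀ m : ℤ, G m = G (m - 1) + G (m - 2)) (m n r : ℤ) :
    F n * G (m - r) = (-1 : ℝ) ^ r * (F (n + r) * G m - F r * G (m + n)) := by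
  have h1 := fib_rec_add F G hF0 hF1 hF hG m (-r)
  have h2 := fib_rec_add F G hF0 hF1 hF hG m n
  have h3 := fib_rec_add F F hF0 hF1 hF hF r n
  have h4 : F (-r - 1) = (-1 : ℝ) ^ r * F (r + 1) := by
    rw [show -r - 1 = -(r + 1) by ring, fib_rec_neg F hF0 hF1 hF,
      zpow_add_one₀ (by norm_num)]
    ring
  rw [← sub_eq_add_neg, fib_rec_neg F hF0 hF1 hF, h4] at h1
  rw [h1, h2, add_comm n r, h3]
  ring

/-- Weighted sum identity for generalized Fibonacci sequences
(Adegoke, Theorem 2, third identity). -/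
theorem stmt_2 (F G : ℤ → ℝ)
    (hF0 : F 0 = 0) (hF1 : F 1 = 1)
    (hF : ∀ m : ℤ, F m = F (m - 1) + F (m - 2))
    (hG : ∀ m : ℤ, G m = G (m - 1) + G (m - 2))
    (m n r : ℤ) (hn : n ≠ 0) (hnr : n + r ≠ 0) (k : ℕ) :
    ∑ j ∈ Finset.range (k + 1), (F r / F (n + r)) ^ j * G (m - r + n * j)
      = (-1 : ℝ) ^ r * (F (n + r) / F n) * G m
        - (-1 : ℝ) ^ r * (F r / F n) * (F r / F (n + r)) ^ k
            * G (m + (k + 1) * n) := by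
  have hFn := fib_rec_ne_zero F hF0 hF1 hF n hn
  have hFnr := fib_rec_ne_zero F hF0 hF1 hF (n + r) hnr
  have hstep (a : ℤ) : G (a - r) =
      (-1 : ℝ) ^ r * (F (n + r) / F n) * G a - (-1 : ℝ) ^ r * (F r / F n) * G (a + n) := by
    have h := fib_rec_mul_sub F G hF0 hF1 hF hG a n r
    field_simp
    linear_combination h
  induction k with
  | zero => simpa using hstep m
  | succ k ih =>
    rw [Finset.sum_range_succ, ih]
    push_cast
    rw [show m - r + n * ((k : ℤ) + 1) = m + (k + 1) * n - r by ring, hstep,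
      show m + ((k : ℤ) + 1 + 1) * n = m + (k + 1) * n + n by ring, pow_succ]
    field_simp
    ring
end

section
/- For all integers m, n, r with n ≠ 0 (so that F(n) ≠ 0) and every nonnegative integer k: ∑_{j=0}^{k} (-1)^{r·j} · C(k,j) · (F(r)/F(n))^j · G(m−r·k+(n+r)·j) = (-1)^{r·k} · (F(n+r)/F(n))^k · G(m), where C(k,j) denotes the binomial coefficient. -/
theorem fibRec_eq_of_eq_zero_one {H K : ℤ → ℝ}
    (hH : ∀ m : ℤ, H m = H (m - 1) + H (m - 2))
    (hK : ∀ m : ℤ, K m = K (m - 1) + K (m - 2))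
    (h0 : H 0 = K 0) (h1 : H 1 = K 1) (m : ℤ) : H m = K m := by
  suffices h : H m = K m ∧ H (m + 1) = K (m + 1) from h.1
  induction m using Int.induction_on with
  | zero => exact ⟨h0, by simpa using h1⟩
  | succ i ih =>
    refine ⟨ih.2, ?_⟩
    have a := hH (i + 1 + 1)
    have b := hK (i + 1 + 1)
    rw [show (i : ℤ) + 1 + 1 - 1 = i + 1 by ring, show (i : ℤ) + 1 + 1 - 2 = i by ring] at a b
    linarith [ih.1, ih.2]
  | pred i ih =>
    have a := hH (-i + 1)
    have b := hK (-i + 1)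
    rw [show -(i : ℤ) + 1 - 1 = -i by ring, show -(i : ℤ) + 1 - 2 = -i - 1 by ring] at a b
    rw [sub_add_cancel]
    exact ⟨by linarith [ih.1, ih.2], ih.1⟩

theorem fibRec_add {F G : ℤ → ℝ} (hF0 : F 0 = 0) (hF1 : F 1 = 1)
    (hF : ∀ m : ℤ, F m = F (m - 1) + F (m - 2))
    (hG : ∀ m : ℤ, G m = G (m - 1) + G (m - 2)) (m n : ℤ) :
    G (m + n) = F n * G (m + 1) + F (n - 1) * G m := by
  refine fibRec_eq_of_eq_zero_one (H := fun n => G (m + n))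
    (K := fun n => F n * G (m + 1) + F (n - 1) * G m) ?_ ?_ ?_ ?_ n
  · intro n
    simpa only [add_sub_assoc] using hG (m + n)
  · intro n
    have a := hF n
    have b := hF (n - 1)
    rw [show n - 1 - 2 = n - 2 - 1 by ring] at b
    linear_combination G (m + 1) * a + G m * b
  · have a := hF 1
    norm_num [hF0, hF1] at a
    simp [hF0, ← a]
  · simp [hF0, hF1]

theorem fibRec_sub {F G : ℤ → ℝ} (hF0 : F 0 = 0) (hF1 : F 1 = 1)
    (hF : ∀ m : ℤ, F m = F (m - 1) + F (m - 2))
    (hG : ∀ m : ℤ, G m = G (m - 1) + G (m - 2)) (m r : ℤ) :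
    (-1 : ℝ) ^ r * G (m - r) = F (r + 1) * G m - F r * G (m + 1) := by
  refine fibRec_eq_of_eq_zero_one (H := fun r => (-1 : ℝ) ^ r * G (m - r))
    (K := fun r => F (r + 1) * G m - F r * G (m + 1)) ?_ ?_ ?_ ?_ r
  · intro r
    have a := hG (m - (r - 2))
    rw [show m - (r - 2) - 1 = m - (r - 1) by ring, show m - (r - 2) - 2 = m - r by ring] at a
    have e1 : (-1 : ℝ) ^ (r - 1) = -(-1) ^ r := by
      rw [zpow_sub_one₀ (by norm_num)]; norm_num
    have e2 : (-1 : ℝ) ^ (r - 2) = (-1) ^ r := by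
      rw [zpow_sub₀ (by norm_num)]; norm_num
    simp only [e1, e2]
    linear_combination -(-1 : ℝ) ^ r * a
  · intro r
    have a := hF r
    have b := hF (r + 1)
    rw [show r + 1 - 1 = r - 1 + 1 by ring, show r + 1 - 2 = r - 2 + 1 by ring] at b
    linear_combination G m * b - G (m + 1) * a
  · simp [hF0, hF1]
  · have a := hF 2
    have b := hG (m + 1)
    rw [show m + 1 - 1 = m by ring, show m + 1 - 2 = m - 1 by ring] at b
    norm_num [hF0, hF1] at a ⊢
    rw [a]
    linarith

theorem fib_ne_zero {F : ℤ → ℝ} (hF0 : F 0 = 0) (hF1 : F 1 = 1)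
    (hF : ∀ m : ℤ, F m = F (m - 1) + F (m - 2)) {n : ℤ} (hn : n ≠ 0) : F n ≠ 0 := by
  have pos (i : ℕ) : 0 ≤ F i ∧ 0 < F (i + 1) := by
    induction i with
    | zero => simp [hF0, hF1]
    | succ i ih =>
      have a := hF (i + 1 + 1)
      rw [show (i : ℤ) + 1 + 1 - 1 = i + 1 by ring, show (i : ℤ) + 1 + 1 - 2 = i by ring] at a
      push_cast
      exact ⟨ih.2.le, by linarith [ih.1, ih.2]⟩
  have pos' (i : ℤ) (hi : 0 < i) : 0 < F i := by
    obtain ⟨j, hj⟩ := Int.eq_ofNat_of_zero_le (show 0 ≤ i - 1 by omega)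
    rw [show i = j + 1 by omega]
    exact (pos j).2
  rcases hn.lt_or_gt with h | h
  · intro h0
    have a := fibRec_sub hF0 hF1 hF hF 0 (-n)
    have b := pos' (-n) (by omega)
    simp [hF0, hF1, h0] at a
    exact b.ne' a
  · exact (pos' n h).ne'

theorem sum_choose_mul_pow_of_three_term {G : ℤ → ℝ} {c A : ℝ} {n r : ℤ}
    (h : ∀ m : ℤ, G (m - r) + c * G (m + n) = A * G m) (k : ℕ) (m : ℤ) :
    ∑ j ∈ Finset.range (k + 1), (k.choose j : ℝ) * c ^ j * G (m - r * k + (n + r) * j)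
      = A ^ k * G m := by
  induction k generalizing m with
  | zero => simp
  | succ k ih =>
    have split : ∑ j ∈ Finset.range (k + 1 + 1), ((k + 1).choose j : ℝ) * c ^ j *
          G (m - r * (k + 1 : ℕ) + (n + r) * j)
        = (∑ j ∈ Finset.range (k + 1), (k.choose j : ℝ) * c ^ j *
            G (m - r - r * k + (n + r) * j))
          + c * ∑ j ∈ Finset.range (k + 1), (k.choose j : ℝ) * c ^ j *
            G (m + n - r * k + (n + r) * j) := by
      have extend : ∑ j ∈ Finset.range (k + 1), (k.choose j : ℝ) * c ^ j *
            G (m - r - r * k + (n + r) * j)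
          = ∑ j ∈ Finset.range (k + 1 + 1), (k.choose j : ℝ) * c ^ j *
            G (m - r - r * k + (n + r) * j) := by
        rw [Finset.sum_range_succ _ (k + 1)]
        simp
      rw [extend, Finset.sum_range_succ', Finset.sum_range_succ' _ (k + 1), Finset.mul_sum,
        add_right_comm, ← Finset.sum_add_distrib]
      congr 1
      · refine Finset.sum_congr rfl fun j _ => ?_
        rw [Nat.choose_succ_succ,
          show m - r * (k + 1 : ℕ) + (n + r) * (j + 1 : ℕ) = m + n - r * k + (n + r) * j by
            push_cast; ring,
          show m - r - r * k + (n + r) * (j + 1 : ℕ) = m + n - r * k + (n + r) * j by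
            push_cast; ring]
        push_cast
        ring
      · rw [show m - r * (k + 1 : ℕ) = m - r - r * k by push_cast; ring]
        simp
    rw [split, ih, ih]
    linear_combination A ^ k * h m


/-- Weighted binomial sum identity for generalized Fibonacci sequences
(Adegoke, Theorem 5, identity (16)). -/
theorem stmt_4 (F G : ℤ → ℝ)
    (hF0 : F 0 = 0) (hF1 : F 1 = 1)
    (hF : ∀ m : ℤ, F m = F (m - 1) + F (m - 2))
    (hG : ∀ m : ℤ, G m = G (m - 1) + G (m - 2))
    (m n r : ℤ) (hn : n ≠ 0) (k : ℕ) :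
    ∑ j ∈ Finset.range (k + 1),
        (-1 : ℝ) ^ (r * (j : ℤ)) * (Nat.choose k j : ℝ) * (F r / F n) ^ j
          * G (m - r * k + (n + r) * j)
      = (-1 : ℝ) ^ (r * (k : ℤ)) * (F (n + r) / F n) ^ k * G m := by
  have hn0 := fib_ne_zero hF0 hF1 hF hn
  have sq : (-1 : ℝ) ^ r * (-1 : ℝ) ^ r = 1 := by
    rw [← mul_zpow]; norm_num
  have three_term (m : ℤ) : G (m - r) + (-1 : ℝ) ^ r * (F r / F n) * G (m + n)
      = (-1 : ℝ) ^ r * (F (n + r) / F n) * G m := by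
    have a := fibRec_add hF0 hF1 hF hG m n
    have b := fibRec_sub hF0 hF1 hF hG m r
    have c := fibRec_add hF0 hF1 hF hF r n
    rw [add_comm r n] at c
    field_simp
    linear_combination (-1 : ℝ) ^ r * F n * b + (-1 : ℝ) ^ r * F r * a
      - (-1 : ℝ) ^ r * G m * c - F n * G (m - r) * sq
  have key := sum_choose_mul_pow_of_three_term three_term k m
  simp only [mul_pow] at key
  simp only [zpow_mul, zpow_natCast]
  rw [← key]
  exact Finset.sum_congr rfl fun j _ => by ring
end
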